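/- Let B' be the Borel subgroup of upper triangular matrices in SL(2, ℂ) (or its Lie-algebra analogue). Every finite-dimensional indecomposable rational representation of B' is isomorphic to V' ⊗ ℂ_λ, where V' is an irreducible representation of SL(2, ℂ) and ℂ_λ is a one-dimensional character of B'. -/

import Mathlib

open Matrix

/-- The Borel subgroup of upper triangular matrices in `SL(2, ℂ)`. -/
def BorelSL2 : Subgroup (Matrix.SpecialLinearGroup (Fin 2) ℂ) where
  carrier := {g | (g : Matrix (Fin 2) (Fin 2) ℂ) 1 0 = 0}
  one_mem' := by simp
  mul_mem' := by
    intro a b ha hb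
    simp only [Set.mem_setOf_eq] at *
    simp [Matrix.SpecialLinearGroup.coe_mul, Matrix.mul_apply, Fin.sum_univ_two, ha, hb]
  inv_mem' := by
    intro a ha
    simp only [Set.mem_setOf_eq] at *
    rw [Matrix.SpecialLinearGroup.coe_inv, Matrix.adjugate_fin_two]
    simp [ha]

/-- A representation of a group of `2 × 2` matrices is rational (algebraic) if all its
matrix coefficients are polynomial functions of the matrix entries.  (On `SL₂` and its
Borel this is the usual notion, since `g 1 1 = (g 0 0)⁻¹` on the Borel and
`det g = 1`.) -/
def IsRationalRep {G : Type*} [Monoid G]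
    (entries : G → Matrix (Fin 2) (Fin 2) ℂ)
    {W : Type*} [AddCommGroup W] [Module ℂ W] (ρ : Representation ℂ G W) : Prop :=
  ∀ (f : W →ₗ[ℂ] ℂ) (v : W), ∃ p : MvPolynomial (Fin 2 × Fin 2) ℂ,
    ∀ g : G, f (ρ g v) = MvPolynomial.eval (fun ij => entries g ij.1 ij.2) p

/-- The matrix of an element of the Borel. -/
def borelEntries (g : ↥BorelSL2) : Matrix (Fin 2) (Fin 2) ℂ :=
  ((g : Matrix.SpecialLinearGroup (Fin 2) ℂ) : Matrix (Fin 2) (Fin 2) ℂ)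

/-- The matrix of an element of `SL(2, ℂ)`. -/
def sl2Entries (g : Matrix.SpecialLinearGroup (Fin 2) ℂ) : Matrix (Fin 2) (Fin 2) ℂ :=
  (g : Matrix (Fin 2) (Fin 2) ℂ)

section Expansions

open Finset

lemma coeff_mem_of_sum_pow_smul_mem {M : Type*} [AddCommGroup M] [Module ℂ M]
    (U : Submodule ℂ M) {N : ℕ} {Q : ℕ → M}
    (h : ∀ x : ℂ, x ≠ 0 → ∑ k ∈ range N, x ^ k • Q k ∈ U) {k : ℕ} (hk : k < N) :
    Q k ∈ U := by
  rw [← Submodule.Quotient.mk_eq_zero, ← Module.forall_dual_apply_eq_zero_iff ℂ]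
  intro f
  set p : Polynomial ℂ :=
    ∑ k ∈ range N, Polynomial.monomial k (f (Submodule.Quotient.mk (Q k))) with hp
  have hroot : ∀ x : ℂ, x ≠ 0 → p.eval x = 0 := by
    intro x hx
    have := congrArg f ((Submodule.Quotient.mk_eq_zero U).2 (h x hx))
    rw [← Submodule.mkQ_apply] at this
    simp only [map_sum, map_smul, map_zero, Submodule.mkQ_apply, smul_eq_mul] at this
    simp only [hp, Polynomial.eval_finsetSum, Polynomial.eval_monomial]
    rw [← this]
    exact sum_congr rfl fun _ _ => mul_comm _ _
  have hzero : p = 0 := by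
    refine Polynomial.eq_zero_of_infinite_isRoot p ?_
    exact (Set.infinite_of_finite_compl (s := {0}ᶜ) (by simp)).mono fun x hx => hroot x hx
  have := congrArg (fun q => Polynomial.coeff q k) hzero
  simpa [hp, Polynomial.finsetSum_coeff, Polynomial.coeff_monomial, hk] using this

lemma coeff_eq_of_sum_pow_smul_eq {M : Type*} [AddCommGroup M] [Module ℂ M]
    {N : ℕ} {Q R : ℕ → M}
    (h : ∀ x : ℂ, x ≠ 0 → ∑ k ∈ range N, x ^ k • Q k = ∑ k ∈ range N, x ^ k • R k)
    {k : ℕ} (hk : k < N) : Q k = R k := by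
  have := coeff_mem_of_sum_pow_smul_mem (⊥ : Submodule ℂ M) (N := N) (Q := fun k => Q k - R k)
    (fun x hx => by simp [smul_sub, h x hx]) hk
  exact sub_eq_zero.1 (by simpa using this)

lemma exists_expansion_of_polynomial_coeffs {W : Type*} [AddCommGroup W] [Module ℂ W]
    {ι : Type*} [Fintype ι] (b : Module.Basis ι ℂ W) {S : Set ℂ} {F : ℂ → Module.End ℂ W}
    (h : ∀ i j, ∃ q : Polynomial ℂ, ∀ x ∈ S, b.coord i (F x (b j)) = q.eval x) :
    ∃ (N : ℕ) (Q : ℕ → Module.End ℂ W), ∀ x ∈ S, F x = ∑ k ∈ range N, x ^ k • Q k := by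
  classical
  choose q hq using h
  refine ⟨(univ.sup fun ij : _ × _ => (q ij.1 ij.2).natDegree) + 1,
    fun k => Matrix.toLin b b (Matrix.of fun i j => (q i j).coeff k), fun x hx => ?_⟩
  refine b.ext fun j => b.ext_elem fun i => ?_
  rw [← b.coord_apply, hq i j x hx, Polynomial.eval_eq_sum_range' (n := _)
    (Nat.lt_succ_of_le (le_sup (f := fun ij : _ × _ => (q ij.1 ij.2).natDegree)
      (mem_univ (i, j))))]
  simp [Matrix.toLin_self, Finsupp.single_apply, mul_comm]

lemma exists_pow_mul_eval_diagonal (p : MvPolynomial (Fin 2 × Fin 2) ℂ) :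
    ∃ d₀ : ℕ, ∀ d, d₀ ≤ d → ∃ q : Polynomial ℂ, ∀ a : ℂ, a ≠ 0 →
      a ^ d * MvPolynomial.eval (fun ij => (!![a, 0; 0, a⁻¹] : Matrix _ _ ℂ) ij.1 ij.2) p
        = q.eval a := by
  induction p using MvPolynomial.induction_on with
  | C c =>
    exact ⟨0, fun d _ => ⟨Polynomial.X ^ d * Polynomial.C c, fun a _ => by
      rw [MvPolynomial.eval_C, Polynomial.eval_mul, Polynomial.eval_pow, Polynomial.eval_X,
        Polynomial.eval_C]⟩⟩
  | add p q hp hq =>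
    obtain ⟨d₁, h₁⟩ := hp
    obtain ⟨d₂, h₂⟩ := hq
    refine ⟨max d₁ d₂, fun d hd => ?_⟩
    obtain ⟨q₁, h₁⟩ := h₁ d (le_of_max_le_left hd)
    obtain ⟨q₂, h₂⟩ := h₂ d (le_of_max_le_right hd)
    exact ⟨q₁ + q₂, fun a ha => by simp [mul_add, ← h₁ a ha, ← h₂ a ha]⟩
  | mul_X p ij hp =>
    obtain ⟨d₀, h⟩ := hp
    refine ⟨d₀ + 1, fun d hd => ?_⟩
    obtain ⟨d, rfl⟩ : ∃ e, d = e + 1 := ⟨d - 1, by omega⟩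
    obtain ⟨q, hq⟩ := h d (by omega)
    obtain ⟨i, j⟩ := ij
    fin_cases i <;> fin_cases j
    · refine ⟨q * Polynomial.X ^ 2, fun a ha => ?_⟩
      simp [← hq a ha]; ring
    · exact ⟨0, fun a ha => by simp⟩
    · exact ⟨0, fun a ha => by simp⟩
    · refine ⟨q, fun a ha => ?_⟩
      rw [← hq a ha, map_mul, MvPolynomial.eval_X, pow_succ]
      simp only [Fin.mk_one, Matrix.of_apply, Matrix.cons_val_one]
      generalize MvPolynomial.eval _ p = e
      simp [mul_assoc, mul_left_comm a, ha]

end Expansions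

section BinaryForms

open Finset

universe u

/-- The monomial `s ^ (n - k) * t ^ k` as a function of the row vector `(s, t)`. -/
def binaryMonomial (n k : ℕ) : ULift.{u} (Fin 2 → ℂ) → ℂ :=
  fun z => z.down 0 ^ (n - k) * z.down 1 ^ k

/-- The space of binary forms of degree `n`, as functions of a row vector. -/
def binaryForms (n : ℕ) : Submodule ℂ (ULift.{u} (Fin 2 → ℂ) → ℂ) :=
  Submodule.span ℂ (binaryMonomial n '' range (n + 1))

lemma binaryMonomial_mem {n k : ℕ} (hk : k ≤ n) : binaryMonomial.{u} n k ∈ binaryForms n :=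
  Submodule.subset_span ⟨k, by simpa using Nat.lt_succ_of_le hk, rfl⟩

lemma mem_binaryForms {n : ℕ} {f : ULift.{u} (Fin 2 → ℂ) → ℂ} :
    f ∈ binaryForms n ↔ ∃ c : ℕ → ℂ, f = ∑ k ∈ range (n + 1), c k • binaryMonomial n k := by
  simp only [binaryForms, Submodule.mem_span_image_finset_iff_exists_fun', eq_comm]

lemma sum_smul_binaryMonomial_apply (n : ℕ) (c : ℕ → ℂ) (x : ℂ) :
    (∑ k ∈ range (n + 1), c k • binaryMonomial.{u} n k) ⟨![1, x]⟩ =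
      ∑ k ∈ range (n + 1), x ^ k • c k := by
  simp [binaryMonomial, mul_comm]

lemma binaryForms_ext {n : ℕ} {f h : binaryForms.{u} n}
    (hfh : ∀ x : ℂ, f.1 ⟨![1, x]⟩ = h.1 ⟨![1, x]⟩) : f = h := by
  obtain ⟨f, hf⟩ := f
  obtain ⟨h, hh⟩ := h
  obtain ⟨c, rfl⟩ := mem_binaryForms.1 hf
  obtain ⟨c', rfl⟩ := mem_binaryForms.1 hh
  rw [Subtype.mk.injEq]
  refine sum_congr rfl fun k hk => ?_
  simp only [sum_smul_binaryMonomial_apply] at hfh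
  rw [coeff_eq_of_sum_pow_smul_eq (fun x _ => hfh x) (mem_range.1 hk)]

/-- Right translation of functions of a row vector. -/
def rowTranslate (g : Matrix (Fin 2) (Fin 2) ℂ) :
    (ULift.{u} (Fin 2 → ℂ) → ℂ) →ₗ[ℂ] (ULift.{u} (Fin 2 → ℂ) → ℂ) :=
  LinearMap.funLeft ℂ ℂ fun z => ⟨z.down ᵥ* g⟩

lemma rowTranslate_apply (g : Matrix (Fin 2) (Fin 2) ℂ) (f : ULift.{u} (Fin 2 → ℂ) → ℂ)
    (z : ULift.{u} (Fin 2 → ℂ)) : rowTranslate g f z = f ⟨z.down ᵥ* g⟩ := rfl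

lemma rowTranslate_binaryMonomial (g : Matrix (Fin 2) (Fin 2) ℂ) {n k : ℕ} (hk : k ≤ n) :
    rowTranslate g (binaryMonomial.{u} n k) =
      ∑ i ∈ range (n - k + 1), ∑ j ∈ range (k + 1),
        (g 0 0 ^ i * g 1 0 ^ (n - k - i) * (n - k).choose i *
          (g 0 1 ^ j * g 1 1 ^ (k - j) * k.choose j)) • binaryMonomial n (n - i - j) := by
  funext z
  simp only [rowTranslate_apply, binaryMonomial, Matrix.vecMul, dotProduct, Fin.sum_univ_two,
    Finset.sum_apply, Pi.smul_apply, smul_eq_mul]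
  rw [add_pow, add_pow, sum_mul_sum]
  refine sum_congr rfl fun i hi => sum_congr rfl fun j hj => ?_
  rw [mem_range] at hi hj
  have h₁ : n - (n - i - j) = i + j := by omega
  have h₂ : n - i - j = (n - k - i) + (k - j) := by omega
  rw [h₁, h₂]
  ring

lemma rowTranslate_mem (g : Matrix (Fin 2) (Fin 2) ℂ) {n : ℕ}
    {f : ULift.{u} (Fin 2 → ℂ) → ℂ} (hf : f ∈ binaryForms n) :
    rowTranslate g f ∈ binaryForms n := by
  obtain ⟨c, rfl⟩ := mem_binaryForms.1 hf
  rw [map_sum]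
  refine sum_mem fun k hk => ?_
  rw [map_smul, rowTranslate_binaryMonomial g (Nat.lt_succ_iff.1 (mem_range.1 hk))]
  exact Submodule.smul_mem _ _ (sum_mem fun i _ => sum_mem fun j _ =>
    Submodule.smul_mem _ _ (binaryMonomial_mem (by omega)))

/-- The representation of `SL(2, ℂ)` on binary forms of degree `n`, that is, the `n`-th
symmetric power of the standard representation. -/
def binaryFormsRep (n : ℕ) :
    Representation ℂ (Matrix.SpecialLinearGroup (Fin 2) ℂ) (binaryForms.{u} n) where
  toFun g := (rowTranslate (g : Matrix (Fin 2) (Fin 2) ℂ)).restrict fun _ => rowTranslate_mem _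
  map_one' := by
    ext f z
    simp [rowTranslate_apply]
  map_mul' g h := by
    ext f z
    simp [rowTranslate_apply, Matrix.vecMul_vecMul]

lemma coe_binaryFormsRep (n : ℕ) (g : Matrix.SpecialLinearGroup (Fin 2) ℂ)
    (f : binaryForms.{u} n) : (binaryFormsRep n g f : _ → ℂ) = rowTranslate g.1 f.1 := rfl

lemma isRationalRep_binaryFormsRep (n : ℕ) :
    IsRationalRep sl2Entries (binaryFormsRep.{u} n) := by
  rintro F ⟨v, hv⟩
  obtain ⟨F', rfl⟩ := LinearMap.exists_extend F
  obtain ⟨c, rfl⟩ := mem_binaryForms.1 hv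
  refine ⟨∑ k ∈ range (n + 1), MvPolynomial.C (c k) *
    ∑ i ∈ range (n - k + 1), ∑ j ∈ range (k + 1),
        (MvPolynomial.X (0, 0) ^ i * MvPolynomial.X (1, 0) ^ (n - k - i) *
          MvPolynomial.C ((n - k).choose i : ℂ) *
          (MvPolynomial.X (0, 1) ^ j * MvPolynomial.X (1, 1) ^ (k - j) *
            MvPolynomial.C (k.choose j : ℂ))) *
          MvPolynomial.C (F' (binaryMonomial n (n - i - j))), fun g => ?_⟩
  simp only [LinearMap.comp_apply, Submodule.subtype_apply, coe_binaryFormsRep, map_sum, map_smul,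
    map_mul, map_pow, MvPolynomial.eval_C, MvPolynomial.eval_X, smul_eq_mul]
  refine sum_congr rfl fun k hk => ?_
  rw [rowTranslate_binaryMonomial g.1 (Nat.lt_succ_iff.1 (mem_range.1 hk))]
  simp only [map_sum, map_smul, smul_eq_mul, sl2Entries]

lemma binaryFormsRep_irreducible (n : ℕ) (U : Submodule ℂ (binaryForms.{u} n))
    (hU : ∀ g : Matrix.SpecialLinearGroup (Fin 2) ℂ, ∀ v ∈ U, binaryFormsRep n g v ∈ U) :
    U = ⊥ ∨ U = ⊤ := by
  refine or_iff_not_imp_left.2 fun hne => ?_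
  obtain ⟨⟨f, hf⟩, hfU, hf0⟩ := U.exists_mem_ne_zero_of_ne_bot hne
  obtain ⟨c, rfl⟩ := mem_binaryForms.1 hf
  set V := U.map (binaryForms.{u} n).subtype with hV
  have hVg : ∀ g : Matrix.SpecialLinearGroup (Fin 2) ℂ, ∀ v ∈ V, rowTranslate g.1 v ∈ V := by
    rintro g _ ⟨v, hv, rfl⟩
    exact ⟨_, hU g v hv, rfl⟩
  have hfV : ∑ k ∈ range (n + 1), c k • binaryMonomial n k ∈ V := ⟨_, hfU, rfl⟩
  obtain ⟨d, hd, hcd, hmax⟩ : ∃ d ≤ n, c d ≠ 0 ∧ ∀ k ≤ n, d < k → c k = 0 := by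
    have hs : ((range (n + 1)).filter fun k => c k ≠ 0).Nonempty := by
      by_contra hs
      rw [not_nonempty_iff_eq_empty, filter_eq_empty_iff] at hs
      refine hf0 (Subtype.ext ?_)
      change ∑ k ∈ range (n + 1), c k • binaryMonomial.{u} n k = 0
      refine sum_eq_zero fun k hk => ?_
      rw [not_not.1 (hs hk), zero_smul]
    obtain ⟨h₁, h₂⟩ := mem_filter.1 (max'_mem _ hs)
    refine ⟨_, Nat.lt_succ_iff.1 (mem_range.1 h₁), h₂, fun k hk hlt => ?_⟩
    by_contra hck
    exact (le_max' _ k (mem_filter.2 ⟨mem_range.2 (Nat.lt_succ_of_le hk), hck⟩)).not_gt hlt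
  have hupper : ∀ x : ℂ, ∑ j ∈ range (n + 1), x ^ j • ∑ k ∈ range (n + 1),
      (c k * k.choose j) • binaryMonomial.{u} n (k - j) ∈ V := by
    intro x
    have := hVg ⟨!![1, x; 0, 1], by simp [Matrix.det_fin_two]⟩ _ hfV
    convert this using 1
    rw [map_sum]
    simp only [smul_sum]
    rw [sum_comm]
    refine sum_congr rfl fun k hk => ?_
    have hk' : k + 1 ≤ n + 1 := mem_range.1 hk
    rw [map_smul]
    funext z
    simp only [rowTranslate_apply, binaryMonomial, Finset.sum_apply, Pi.smul_apply, smul_eq_mul,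
      Matrix.vecMul, dotProduct, Fin.sum_univ_two]
    simp only [Matrix.of_apply, Matrix.cons_val_zero, Matrix.cons_val_one, mul_one, mul_zero,
      add_zero]
    rw [add_pow, mul_sum, mul_sum,
      ← sum_subset (range_subset_range.2 hk') (fun j _ hj => by
        rw [Nat.choose_eq_zero_of_lt (by simpa using hj)]; simp)]
    refine sum_congr rfl fun j hj => ?_
    have h₁ : n - (k - j) = (n - k) + j := by
      have := mem_range.1 hj
      omega
    rw [h₁, pow_add, mul_pow]
    ring
  have hs : binaryMonomial.{u} n 0 ∈ V := by
    have := coeff_mem_of_sum_pow_smul_mem V (fun x _ => hupper x) (Nat.lt_succ_of_le hd)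
    rw [sum_eq_single d] at this
    · simpa [hcd] using (Submodule.smul_mem_iff V (by simpa using hcd)).1 this
    · intro k hk hkd
      rcases lt_or_gt_of_ne hkd with h | h
      · simp [Nat.choose_eq_zero_of_lt h]
      · simp [hmax k (Nat.lt_succ_iff.1 (mem_range.1 hk)) h]
    · intro h
      exact absurd (mem_range.2 (Nat.lt_succ_of_le hd)) h
  have hlower : ∀ x : ℂ, ∑ k ∈ range (n + 1),
      x ^ k • (n.choose k : ℂ) • binaryMonomial.{u} n k ∈ V := by
    intro x
    have := hVg ⟨!![1, 0; x, 1], by simp [Matrix.det_fin_two]⟩ _ hs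
    convert this using 1
    funext z
    simp only [rowTranslate_apply, binaryMonomial, Finset.sum_apply, Pi.smul_apply, smul_eq_mul,
      Matrix.vecMul, dotProduct, Fin.sum_univ_two]
    simp only [Matrix.of_apply, Matrix.cons_val_zero, Matrix.cons_val_one, mul_one, pow_zero,
      tsub_zero]
    rw [add_comm (z.down 0), add_pow]
    refine sum_congr rfl fun k _ => ?_
    rw [mul_pow]
    ring
  have hle : binaryForms.{u} n ≤ V := by
    refine Submodule.span_le.2 ?_
    rintro _ ⟨k, hk, rfl⟩
    have := coeff_mem_of_sum_pow_smul_mem V (fun x _ => hlower x) (mem_range.1 hk)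
    have hchoose := Nat.choose_pos (Nat.lt_succ_iff.1 (mem_range.1 hk))
    exact (Submodule.smul_mem_iff V (by exact_mod_cast hchoose.ne')).1 this
  refine eq_top_iff.2 fun f _ => ?_
  obtain ⟨f', hf', h⟩ := hle f.2
  rwa [← Subtype.ext h]

end BinaryForms

section Borel

open Finset

/-- The diagonal element of the Borel subgroup with entries `a` and `a⁻¹`. -/
noncomputable def borelTorus (a : ℂˣ) : BorelSL2 :=
  ⟨⟨!![(a : ℂ), 0; 0, (a : ℂ)⁻¹], by simp [Matrix.det_fin_two]⟩, by
    change (!![(a : ℂ), 0; 0, (a : ℂ)⁻¹] : Matrix _ _ ℂ) 1 0 = 0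
    simp⟩

/-- The unipotent element of the Borel subgroup with upper right entry `x`. -/
def borelUnipotent (x : ℂ) : BorelSL2 :=
  ⟨⟨!![1, x; 0, 1], by simp [Matrix.det_fin_two]⟩, by
    change (!![1, x; 0, 1] : Matrix _ _ ℂ) 1 0 = 0
    simp⟩

lemma borelEntries_torus (a : ℂˣ) :
    borelEntries (borelTorus a) = !![(a : ℂ), 0; 0, (a : ℂ)⁻¹] := rfl

lemma borelEntries_unipotent (x : ℂ) : borelEntries (borelUnipotent x) = !![1, x; 0, 1] := rfl

lemma borelEntries_mul (g h : BorelSL2) :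
    borelEntries (g * h) = borelEntries g * borelEntries h := rfl

lemma borelEntries_one : borelEntries 1 = 1 := rfl

lemma borelEntries_injective : Function.Injective borelEntries :=
  fun _ _ h => Subtype.ext (Subtype.ext h)

lemma borelEntries_one_zero (g : BorelSL2) : borelEntries g 1 0 = 0 := g.2

lemma borelEntries_zero_zero_mul_one_one (g : BorelSL2) :
    borelEntries g 0 0 * borelEntries g 1 1 = 1 := by
  have h : (borelEntries g).det = 1 := g.1.2
  rwa [Matrix.det_fin_two, borelEntries_one_zero, mul_zero, sub_zero] at h

lemma borelTorus_one : borelTorus 1 = 1 := by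
  apply borelEntries_injective
  simp [borelEntries_torus, borelEntries_one, Matrix.one_fin_two]

lemma borelUnipotent_zero : borelUnipotent 0 = 1 := by
  apply borelEntries_injective
  simp [borelEntries_unipotent, borelEntries_one, Matrix.one_fin_two]

lemma borelTorus_mul (a b : ℂˣ) : borelTorus a * borelTorus b = borelTorus (a * b) := by
  apply borelEntries_injective
  simp [borelEntries_mul, borelEntries_torus, mul_comm]

lemma borelUnipotent_mul (x y : ℂ) :
    borelUnipotent x * borelUnipotent y = borelUnipotent (x + y) := by
  apply borelEntries_injective
  simp [borelEntries_mul, borelEntries_unipotent, add_comm]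

lemma borelTorus_mul_unipotent (a : ℂˣ) (x : ℂ) :
    borelTorus a * borelUnipotent x = borelUnipotent ((a : ℂ) ^ 2 * x) * borelTorus a := by
  apply borelEntries_injective
  simp only [borelEntries_mul, borelEntries_unipotent, borelEntries_torus, Matrix.mul_fin_two]
  have ha := a.ne_zero
  have : (a : ℂ) * x = a ^ 2 * x * (a : ℂ)⁻¹ := by field_simp
  simp [this]

lemma exists_eq_borelTorus_mul_unipotent (g : BorelSL2) :
    ∃ (a : ℂˣ) (y : ℂ), g = borelTorus a * borelUnipotent y := by
  have h := borelEntries_zero_zero_mul_one_one g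
  refine ⟨⟨_, _, h, by rw [mul_comm, h]⟩, borelEntries g 1 1 * borelEntries g 0 1, ?_⟩
  apply borelEntries_injective
  rw [borelEntries_mul, borelEntries_torus, borelEntries_unipotent, Matrix.mul_fin_two]
  ext i j
  fin_cases i <;> fin_cases j <;>
    simp [borelEntries_one_zero, ← mul_assoc, eq_inv_of_mul_eq_one_right h,
      left_ne_zero_of_mul_eq_one h]

/-- The character of the Borel subgroup sending a matrix to its upper left entry. -/
def borelCharacter : BorelSL2 →* ℂˣ where
  toFun g := ⟨borelEntries g 0 0, borelEntries g 1 1, borelEntries_zero_zero_mul_one_one g, by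
    rw [mul_comm, borelEntries_zero_zero_mul_one_one]⟩
  map_one' := by
    ext
    simp [borelEntries_one]
  map_mul' g h := by
    ext
    simp [borelEntries_mul, Matrix.mul_apply, Fin.sum_univ_two, borelEntries_one_zero]

lemma borelCharacter_coe (g : BorelSL2) : (borelCharacter g : ℂ) = borelEntries g 0 0 := rfl

lemma borelCharacter_inv_coe (g : BorelSL2) :
    ((borelCharacter g)⁻¹ : ℂˣ) = borelEntries g 1 1 := rfl

lemma exists_polynomial_borelCharacter_zpow (m : ℤ) :
    ∃ p : MvPolynomial (Fin 2 × Fin 2) ℂ, ∀ g : BorelSL2,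
      ((borelCharacter ^ m : BorelSL2 →* ℂˣ) g : ℂ)
        = MvPolynomial.eval (fun ij => borelEntries g ij.1 ij.2) p := by
  obtain ⟨k, rfl | rfl⟩ := m.eq_nat_or_neg
  · exact ⟨MvPolynomial.X (0, 0) ^ k, fun g => by simp [borelCharacter_coe]⟩
  · refine ⟨MvPolynomial.X (1, 1) ^ k, fun g => ?_⟩
    rw [MonoidHom.zpow_apply, _root_.zpow_neg, _root_.zpow_natCast, ← inv_pow,
      Units.val_pow_eq_pow_val, borelCharacter_inv_coe]
    simp

variable {W : Type*} [AddCommGroup W] [Module ℂ W]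
  {ρ : Representation ℂ BorelSL2 W}

lemma exists_torus_expansion [FiniteDimensional ℂ W] (hrat : IsRationalRep borelEntries ρ) :
    ∃ (d N : ℕ) (P : ℕ → Module.End ℂ W), ∀ a : ℂˣ,
      (a : ℂ) ^ d • ρ (borelTorus a) = ∑ k ∈ range N, (a : ℂ) ^ k • P k := by
  let b := Module.finBasis ℂ W
  choose p hp using fun i j => hrat (b.coord i) (b j)
  choose d₀ hd₀ using fun i j => exists_pow_mul_eval_diagonal (p i j)
  let d := univ.sup fun ij : _ × _ => d₀ ij.1 ij.2
  obtain ⟨N, P, hP⟩ := exists_expansion_of_polynomial_coeffs b (S := {0}ᶜ)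
    (F := fun x => if hx : x = 0 then 0 else x ^ d • ρ (borelTorus (Units.mk0 x hx)))
    (fun i j => by
      obtain ⟨q, hq⟩ := hd₀ i j d
        (le_sup (f := fun ij : _ × _ => d₀ ij.1 ij.2) (mem_univ (i, j)))
      refine ⟨q, fun x hx => ?_⟩
      have hx0 : x ≠ 0 := by simpa using hx
      rw [dif_neg hx0, LinearMap.smul_apply, map_smul, hp, smul_eq_mul, ← hq x hx0]
      rfl)
  refine ⟨d, N, P, fun a => ?_⟩
  have := hP a (by simp)
  rwa [dif_neg a.ne_zero, Units.mk0_val] at this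

lemma exists_weight_operators [FiniteDimensional ℂ W] (hrat : IsRationalRep borelEntries ρ) :
    ∃ (d N : ℕ) (P : ℕ → Module.End ℂ W), ∑ k ∈ range N, P k = 1 ∧
      ∀ (a : ℂˣ), ∀ k < N,
        ρ (borelTorus a) * P k = (a : ℂ) ^ ((k : ℤ) - d) • P k ∧
        P k * ρ (borelTorus a) = (a : ℂ) ^ ((k : ℤ) - d) • P k := by
  obtain ⟨d, N, P, hP⟩ := exists_torus_expansion hrat
  refine ⟨d, N, P, ?_, fun a k hk => ?_⟩
  · simpa [borelTorus_one] using (hP 1).symm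
  have hz : (a : ℂ) ^ ((k : ℤ) - d) = ((a : ℂ) ^ d)⁻¹ * (a : ℂ) ^ k := by
    rw [zpow_sub₀ a.ne_zero, zpow_natCast, zpow_natCast, div_eq_inv_mul]
  have key : ∀ c : ℂˣ, ∑ k ∈ range N, (c : ℂ) ^ k • (a : ℂ) ^ k • P k =
      ((a : ℂ) ^ d * (c : ℂ) ^ d) • ρ (borelTorus (a * c)) := by
    intro c
    rw [← mul_pow, ← Units.val_mul, hP]
    refine sum_congr rfl fun k _ => ?_
    rw [smul_smul, Units.val_mul, mul_pow, mul_comm]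
  constructor
  · have : ∀ x : ℂ, x ≠ 0 → ∑ k ∈ range N, x ^ k • ((a : ℂ) ^ d • ρ (borelTorus a) * P k) =
        ∑ k ∈ range N, x ^ k • (a : ℂ) ^ k • P k := by
      intro x hx
      lift x to ℂˣ using hx.isUnit
      rw [key, ← borelTorus_mul, map_mul, ← smul_mul_smul_comm, hP x, mul_sum]
      simp
    rw [hz, mul_smul, ← coeff_eq_of_sum_pow_smul_eq this hk, smul_mul_assoc,
      inv_smul_smul₀ (pow_ne_zero _ a.ne_zero)]
  · have : ∀ x : ℂ, x ≠ 0 → ∑ k ∈ range N, x ^ k • (P k * (a : ℂ) ^ d • ρ (borelTorus a)) =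
        ∑ k ∈ range N, x ^ k • (a : ℂ) ^ k • P k := by
      intro x hx
      lift x to ℂˣ using hx.isUnit
      rw [key, mul_comm a, ← borelTorus_mul, map_mul, mul_comm ((a : ℂ) ^ d),
        ← smul_mul_smul_comm, hP x, sum_mul]
      simp [smul_comm ((a : ℂ) ^ d)]
    rw [hz, mul_smul, ← coeff_eq_of_sum_pow_smul_eq this hk, mul_smul_comm,
      inv_smul_smul₀ (pow_ne_zero _ a.ne_zero)]

lemma exists_unipotent_expansion [FiniteDimensional ℂ W] [Nontrivial W]
    (hrat : IsRationalRep borelEntries ρ) :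
    ∃ (n : ℕ) (E : ℕ → Module.End ℂ W), E n ≠ 0 ∧ ∀ x : ℂ,
      ρ (borelUnipotent x) = ∑ k ∈ range (n + 1), x ^ k • E k := by
  classical
  have hex : ∃ (N : ℕ) (E : ℕ → Module.End ℂ W), ∀ x : ℂ,
      ρ (borelUnipotent x) = ∑ k ∈ range N, x ^ k • E k := by
    let b := Module.finBasis ℂ W
    obtain ⟨N, E, hE⟩ := exists_expansion_of_polynomial_coeffs b (S := Set.univ)
      (F := fun x => ρ (borelUnipotent x)) (fun i j => by
        obtain ⟨p, hp⟩ := hrat (b.coord i) (b j)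
        refine ⟨MvPolynomial.aeval
          (fun ij => (!![1, Polynomial.X; 0, 1] : Matrix _ _ (Polynomial ℂ)) ij.1 ij.2) p,
          fun x _ => ?_⟩
        rw [hp, ← Polynomial.coe_aeval_eq_eval, ← AlgHom.comp_apply, MvPolynomial.comp_aeval,
          ← MvPolynomial.aeval_eq_eval]
        congr! 3 with ij
        obtain ⟨i, j⟩ := ij
        fin_cases i <;> fin_cases j <;> simp [borelEntries_unipotent])
    exact ⟨N, E, fun x => hE x trivial⟩
  obtain ⟨E, hE⟩ := Nat.find_spec hex
  obtain ⟨n, hn⟩ : ∃ n, Nat.find hex = n + 1 := by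
    refine Nat.exists_eq_succ_of_ne_zero fun h0 => ?_
    have := hE 0
    rw [h0, borelUnipotent_zero, map_one, range_zero, sum_empty] at this
    exact one_ne_zero this
  rw [hn] at hE
  refine ⟨n, E, fun h0 => ?_, hE⟩
  refine Nat.find_min hex (m := n) (by omega) ⟨E, fun x => ?_⟩
  rw [hE, sum_range_succ, h0, smul_zero, add_zero]

lemma unipotent_mul_coeff {n : ℕ} {E : ℕ → Module.End ℂ W}
    (hE : ∀ x : ℂ, ρ (borelUnipotent x) = ∑ k ∈ range (n + 1), x ^ k • E k)
    (x : ℂ) {k : ℕ} (hk : k < n + 1) :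
    ρ (borelUnipotent x) * E k =
      ∑ m ∈ range (n + 1), (x ^ (m - k) * m.choose k) • E m := by
  refine coeff_eq_of_sum_pow_smul_eq
    (Q := fun k => ρ (borelUnipotent x) * E k)
    (R := fun k => ∑ m ∈ range (n + 1), (x ^ (m - k) * m.choose k) • E m) (fun y _ => ?_) hk
  simp only [← mul_smul_comm, ← mul_sum]
  rw [← hE, ← map_mul, borelUnipotent_mul, hE]
  simp only [smul_sum]
  rw [sum_comm]
  refine sum_congr rfl fun m hm => ?_
  have hm' : m + 1 ≤ n + 1 := mem_range.1 hm
  simp only [smul_smul, ← sum_smul]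
  congr 1
  rw [← sum_subset (range_subset_range.2 hm') (fun j _ hj => by
    rw [Nat.choose_eq_zero_of_lt (by simpa using hj)]; simp), add_comm, add_pow]
  exact sum_congr rfl fun j _ => by ring

lemma torus_mul_coeff {n : ℕ} {E : ℕ → Module.End ℂ W}
    (hE : ∀ x : ℂ, ρ (borelUnipotent x) = ∑ k ∈ range (n + 1), x ^ k • E k)
    (a : ℂˣ) {k : ℕ} (hk : k < n + 1) :
    ρ (borelTorus a) * E k = (a : ℂ) ^ (2 * k) • (E k * ρ (borelTorus a)) := by
  refine coeff_eq_of_sum_pow_smul_eq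
    (Q := fun k => ρ (borelTorus a) * E k)
    (R := fun k => (a : ℂ) ^ (2 * k) • (E k * ρ (borelTorus a))) (fun x _ => ?_) hk
  simp only [← mul_smul_comm, ← mul_sum]
  rw [← hE, ← map_mul, borelTorus_mul_unipotent, map_mul, hE, sum_mul]
  refine sum_congr rfl fun k _ => ?_
  rw [mul_pow, ← pow_mul, smul_mul_assoc, mul_smul_comm, mul_smul_comm, smul_smul, mul_comm]

lemma exists_weight_pair [FiniteDimensional ℂ W] (hrat : IsRationalRep borelEntries ρ)
    {E : Module.End ℂ W} (hE : E ≠ 0) :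
    ∃ (l : W →ₗ[ℂ] ℂ) (w : W) (r s : ℤ), l (E w) ≠ 0 ∧
      (∀ (a : ℂˣ) (v : W), l (ρ (borelTorus a) v) = (a : ℂ) ^ r * l v) ∧
      ∀ a : ℂˣ, ρ (borelTorus a) w = (a : ℂ) ^ s • w := by
  obtain ⟨d, N, P, hP, hw⟩ := exists_weight_operators hrat
  obtain ⟨i, hi, j, hj, hij⟩ : ∃ i < N, ∃ j < N, P i * E * P j ≠ 0 := by
    by_contra! h
    refine hE ?_
    rw [← one_mul E, ← mul_one (1 * E), ← hP, sum_mul, sum_mul]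
    refine sum_eq_zero fun i hi => ?_
    rw [mul_sum]
    exact sum_eq_zero fun j hj => h i (mem_range.1 hi) j (mem_range.1 hj)
  obtain ⟨v, hv⟩ : ∃ v, (P i * E * P j) v ≠ 0 := by
    by_contra! h
    exact hij (LinearMap.ext h)
  obtain ⟨f, hf⟩ : ∃ f : Module.Dual ℂ W, f ((P i * E * P j) v) ≠ 0 := by
    by_contra! h
    exact hv ((Module.forall_dual_apply_eq_zero_iff ℂ _).1 h)
  refine ⟨f ∘ₗ P i, P j v, (i : ℤ) - d, (j : ℤ) - d, hf, fun a u => ?_, fun a => ?_⟩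
  · have := congrArg (fun T : Module.End ℂ W => f (T u)) (hw a i hi).2
    simpa using this
  · exact congrArg (fun T : Module.End ℂ W => T v) (hw a j hj).1

lemma weight_pair_coeff_eq_zero {n : ℕ} {E : ℕ → Module.End ℂ W}
    (hE : ∀ x : ℂ, ρ (borelUnipotent x) = ∑ k ∈ range (n + 1), x ^ k • E k)
    {l : W →ₗ[ℂ] ℂ} {w : W} {r s : ℤ} (hlw : l (E n w) ≠ 0)
    (hl : ∀ (a : ℂˣ) (v : W), l (ρ (borelTorus a) v) = (a : ℂ) ^ r * l v)
    (hw : ∀ a : ℂˣ, ρ (borelTorus a) w = (a : ℂ) ^ s • w)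
    {k : ℕ} (hk : k < n) : l (E k w) = 0 := by
  have key : ∀ j < n + 1, (2 : ℂ) ^ r * l (E j w) = 2 ^ (2 * j) * (2 ^ s * l (E j w)) := by
    intro j hj
    have h := congrArg (fun T : Module.End ℂ W => l (T w))
      (torus_mul_coeff hE (Units.mk0 2 two_ne_zero) hj)
    simpa [hl, hw] using h
  by_contra hne
  have h₁ := key n (by omega)
  have h₂ := key k (by omega)
  rw [← mul_assoc] at h₁ h₂
  have h := (mul_right_cancel₀ hlw h₁).symm.trans (mul_right_cancel₀ hne h₂)
  have h' := mul_right_cancel₀ (zpow_ne_zero s (two_ne_zero' ℂ)) h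
  have h'' : (2 : ℕ) ^ (2 * n) = 2 ^ (2 * k) := by exact_mod_cast h'
  have := Nat.pow_right_injective le_rfl h''
  omega

universe u

/-- The binary form of degree `n` attached to a vector `v` by a functional `l` and the
coefficients `E k` of the unipotent part of a representation. -/
def toBinaryForms (n : ℕ) (E : ℕ → Module.End ℂ W) (l : W →ₗ[ℂ] ℂ) : W →ₗ[ℂ] binaryForms.{u} n :=
  ∑ k : Fin (n + 1), (l ∘ₗ E k).smulRight
    ⟨binaryMonomial n k, binaryMonomial_mem (Nat.lt_succ_iff.1 k.2)⟩

lemma toBinaryForms_apply {n : ℕ} {E : ℕ → Module.End ℂ W}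
    (hE : ∀ x : ℂ, ρ (borelUnipotent x) = ∑ k ∈ range (n + 1), x ^ k • E k)
    (l : W →ₗ[ℂ] ℂ) (v : W) (x : ℂ) :
    (toBinaryForms.{u} n E l v).1 ⟨![1, x]⟩ = l (ρ (borelUnipotent x) v) := by
  rw [hE, sum_range]
  simp [toBinaryForms, binaryMonomial, mul_comm]

lemma toBinaryForms_equivariant {n : ℕ} {E : ℕ → Module.End ℂ W}
    (hE : ∀ x : ℂ, ρ (borelUnipotent x) = ∑ k ∈ range (n + 1), x ^ k • E k)
    {l : W →ₗ[ℂ] ℂ} {r : ℤ}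
    (hl : ∀ (a : ℂˣ) (v : W), l (ρ (borelTorus a) v) = (a : ℂ) ^ r * l v)
    (g : BorelSL2) (v : W) :
    toBinaryForms.{u} n E l (ρ g v) =
      ((borelCharacter ^ (r - n) : BorelSL2 →* ℂˣ) g : ℂ) •
        binaryFormsRep n g.1 (toBinaryForms.{u} n E l v) := by
  obtain ⟨a, y, rfl⟩ := exists_eq_borelTorus_mul_unipotent g
  refine binaryForms_ext fun x => ?_
  have ha := a.ne_zero
  have hχ : ((borelCharacter ^ (r - n) : BorelSL2 →* ℂˣ)
      (borelTorus a * borelUnipotent y) : ℂ) = (a : ℂ) ^ (r - n : ℤ) := by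
    rw [MonoidHom.zpow_apply, Units.val_zpow_eq_zpow_val, borelCharacter_coe, borelEntries_mul,
      borelEntries_torus, borelEntries_unipotent]
    simp
  have hform : ∀ f : binaryForms.{u} n,
      (binaryFormsRep n (borelTorus a * borelUnipotent y).1 f).1 ⟨![1, x]⟩ =
        (a : ℂ) ^ n * f.1 ⟨![1, y + x / (a : ℂ) ^ 2]⟩ := by
    intro f
    have hrow : (![1, x] : Fin 2 → ℂ) ᵥ* borelEntries (borelTorus a * borelUnipotent y) =
        ![(a : ℂ), a * (y + x / (a : ℂ) ^ 2)] := by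
      rw [borelEntries_mul, borelEntries_torus, borelEntries_unipotent, Matrix.mul_fin_two]
      ext i
      fin_cases i
      · simp [Matrix.vecMul, dotProduct, Fin.sum_univ_two]
      · simp [Matrix.vecMul, dotProduct, Fin.sum_univ_two]
        field_simp
    change f.1 ⟨(![1, x] : Fin 2 → ℂ) ᵥ* borelEntries (borelTorus a * borelUnipotent y)⟩ = _
    rw [hrow]
    obtain ⟨f, hf⟩ := f
    obtain ⟨c, rfl⟩ := mem_binaryForms.1 hf
    simp only [Finset.sum_apply, Pi.smul_apply, smul_eq_mul, binaryMonomial, mul_sum]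
    refine sum_congr rfl fun k hk => ?_
    have hn : n = (n - k) + k := by
      have := mem_range.1 hk
      omega
    simp only [Matrix.cons_val_zero, Matrix.cons_val_one, mul_pow, one_pow, one_mul]
    conv_rhs => rw [hn, pow_add]
    ring
  rw [hχ, Submodule.coe_smul, Pi.smul_apply, hform, toBinaryForms_apply hE,
    toBinaryForms_apply hE, ← Module.End.mul_apply, ← map_mul, ← mul_assoc]
  have hx : borelUnipotent x * borelTorus a =
      borelTorus a * borelUnipotent (x / (a : ℂ) ^ 2) := by
    rw [borelTorus_mul_unipotent, mul_div_cancel₀ _ (pow_ne_zero _ ha)]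
  rw [hx, mul_assoc, borelUnipotent_mul, map_mul, Module.End.mul_apply, hl, smul_eq_mul,
    ← mul_assoc, zpow_sub₀ ha, zpow_natCast, div_mul_cancel₀ _ (pow_ne_zero _ ha), add_comm y]

lemma toBinaryForms_coeff {n : ℕ} {E : ℕ → Module.End ℂ W}
    (hE : ∀ x : ℂ, ρ (borelUnipotent x) = ∑ k ∈ range (n + 1), x ^ k • E k)
    {l : W →ₗ[ℂ] ℂ} {w : W} (hzero : ∀ k < n, l (E k w) = 0) {k : ℕ} (hk : k < n + 1) :
    (toBinaryForms.{u} n E l (E k w)).1 =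
      (n.choose k * l (E n w)) • binaryMonomial n (n - k) := by
  have hmem : (n.choose k * l (E n w)) • binaryMonomial.{u} n (n - k) ∈ binaryForms n :=
    Submodule.smul_mem _ _ (binaryMonomial_mem (Nat.sub_le n k))
  refine congrArg Subtype.val (binaryForms_ext (h := ⟨_, hmem⟩) fun x => ?_)
  rw [toBinaryForms_apply hE, ← Module.End.mul_apply, unipotent_mul_coeff hE x hk,
    LinearMap.sum_apply, map_sum, sum_range_succ, sum_eq_zero fun m hm => by
      simp [hzero m (mem_range.1 hm)]]
  simp [binaryMonomial]
  ring

/-- The span of the vectors `E k w` for `k ≤ n`. -/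
def stringSpan (n : ℕ) (E : ℕ → Module.End ℂ W) (w : W) : Submodule ℂ W :=
  Submodule.span ℂ ((fun k => E k w) '' range (n + 1))

lemma coeff_mem_stringSpan {n k : ℕ} (E : ℕ → Module.End ℂ W) (w : W) (hk : k < n + 1) :
    E k w ∈ stringSpan n E w :=
  Submodule.subset_span ⟨k, mem_coe.2 (mem_range.2 hk), rfl⟩

lemma stringSpan_invariant {n : ℕ} {E : ℕ → Module.End ℂ W}
    (hE : ∀ x : ℂ, ρ (borelUnipotent x) = ∑ k ∈ range (n + 1), x ^ k • E k)
    {w : W} {s : ℤ} (hw : ∀ a : ℂˣ, ρ (borelTorus a) w = (a : ℂ) ^ s • w)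
    (g : BorelSL2) {v : W} (hv : v ∈ stringSpan n E w) : ρ g v ∈ stringSpan n E w := by
  obtain ⟨a, y, rfl⟩ := exists_eq_borelTorus_mul_unipotent g
  have hT : stringSpan n E w ≤ (stringSpan n E w).comap (ρ (borelTorus a)) := by
    refine Submodule.span_le.2 ?_
    rintro _ ⟨k, hk, rfl⟩
    have hk' := mem_range.1 (mem_coe.1 hk)
    have h := congrArg (fun T : Module.End ℂ W => T w) (torus_mul_coeff hE a hk')
    simp only [Module.End.mul_apply, LinearMap.smul_apply, hw, map_smul] at h
    change ρ (borelTorus a) (E k w) ∈ stringSpan n E w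
    rw [h]
    exact Submodule.smul_mem _ _ (Submodule.smul_mem _ _ (coeff_mem_stringSpan E w hk'))
  have hU : stringSpan n E w ≤ (stringSpan n E w).comap (ρ (borelUnipotent y)) := by
    refine Submodule.span_le.2 ?_
    rintro _ ⟨k, hk, rfl⟩
    have h := congrArg (fun T : Module.End ℂ W => T w)
      (unipotent_mul_coeff hE y (mem_range.1 (mem_coe.1 hk)))
    simp only [Module.End.mul_apply, LinearMap.sum_apply, LinearMap.smul_apply] at h
    change ρ (borelUnipotent y) (E k w) ∈ stringSpan n E w
    rw [h]
    exact sum_mem fun m hm =>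
      Submodule.smul_mem _ _ (coeff_mem_stringSpan E w (mem_range.1 hm))
  rw [map_mul]
  exact hT (hU hv)

lemma map_toBinaryForms_stringSpan {n : ℕ} {E : ℕ → Module.End ℂ W}
    (hE : ∀ x : ℂ, ρ (borelUnipotent x) = ∑ k ∈ range (n + 1), x ^ k • E k)
    {l : W →ₗ[ℂ] ℂ} {w : W} (hlw : l (E n w) ≠ 0) (hzero : ∀ k < n, l (E k w) = 0) :
    (stringSpan n E w).map (toBinaryForms.{u} n E l) = ⊤ := by
  refine Submodule.map_injective_of_injective (binaryForms.{u} n).injective_subtype ?_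
  rw [Submodule.map_subtype_top]
  refine le_antisymm (Submodule.map_subtype_le _ _) (Submodule.span_le.2 ?_)
  rintro _ ⟨k, hk, rfl⟩
  have hk' : k ≤ n := Nat.lt_succ_iff.1 (mem_range.1 (mem_coe.1 hk))
  have h : (n.choose (n - k) * l (E n w) : ℂ) ≠ 0 :=
    mul_ne_zero (by exact_mod_cast (Nat.choose_pos (Nat.sub_le n k)).ne') hlw
  rw [SetLike.mem_coe, ← Submodule.smul_mem_iff _ h]
  refine ⟨_, ⟨E (n - k) w, coeff_mem_stringSpan E w (by omega), rfl⟩, ?_⟩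
  rw [Submodule.subtype_apply, toBinaryForms_coeff hE hzero (by omega), Nat.sub_sub_self hk']

lemma isCompl_stringSpan_ker {n : ℕ} {E : ℕ → Module.End ℂ W}
    (hE : ∀ x : ℂ, ρ (borelUnipotent x) = ∑ k ∈ range (n + 1), x ^ k • E k)
    {l : W →ₗ[ℂ] ℂ} {w : W} (hlw : l (E n w) ≠ 0) (hzero : ∀ k < n, l (E k w) = 0) :
    IsCompl (stringSpan n E w) (LinearMap.ker (toBinaryForms.{u} n E l)) := by
  constructor
  · rw [Submodule.disjoint_def]
    intro v hv hker
    obtain ⟨c, rfl⟩ := (Submodule.mem_span_image_finset_iff_exists_fun' ℂ).1 hv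
    have hsum : ∀ x : ℂ, x ≠ 0 → ∑ j ∈ range (n + 1),
        x ^ j • (c (n - j) * (n.choose (n - j) * l (E n w))) = ∑ j ∈ range (n + 1), x ^ j • 0 := by
      intro x _
      have h := congrArg (fun f : binaryForms.{u} n => f.1 ⟨![1, x]⟩) (LinearMap.mem_ker.1 hker)
      simp only [map_sum, map_smul, Submodule.coe_sum, Submodule.coe_smul, Finset.sum_apply,
        Pi.smul_apply, ZeroMemClass.coe_zero, Pi.zero_apply] at h
      simp only [smul_zero, sum_const_zero]
      rw [← h, ← sum_range_reflect]
      refine sum_congr rfl fun k hk => ?_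
      have hk' := mem_range.1 hk
      rw [toBinaryForms_coeff hE hzero hk', Nat.add_sub_cancel,
        Nat.sub_sub_self (Nat.lt_succ_iff.1 hk')]
      simp [binaryMonomial]
      ring
    refine sum_eq_zero fun k hk => ?_
    have hk' : k ≤ n := Nat.lt_succ_iff.1 (mem_range.1 hk)
    have h := coeff_eq_of_sum_pow_smul_eq hsum (k := n - k) (by omega)
    rw [Nat.sub_sub_self hk'] at h
    have hc : c k = 0 := (mul_eq_zero.1 h).resolve_right
      (mul_ne_zero (by exact_mod_cast (Nat.choose_pos hk').ne') hlw)
    rw [hc, zero_smul]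
  · rw [codisjoint_iff, eq_top_iff]
    intro v _
    obtain ⟨u, hu, huv⟩ : toBinaryForms.{u} n E l v ∈
        (stringSpan n E w).map (toBinaryForms.{u} n E l) := by
      rw [map_toBinaryForms_stringSpan hE hlw hzero]
      trivial
    exact Submodule.mem_sup.2 ⟨u, hu, v - u, by simp [huv], by abel⟩

end Borel

/-- Every finite-dimensional indecomposable rational representation of the
Borel subgroup `B'` of upper triangular matrices in `SL(2, ℂ)` is isomorphic to
`V' ⊗ ℂ_λ` for an irreducible (rational) representation `V'` of `SL(2, ℂ)` and a
rational character `ℂ_λ` of `B'`. -/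
theorem indecomposable_rep_of_borel_SL2
    {W : Type*} [AddCommGroup W] [Module ℂ W] [FiniteDimensional ℂ W] [Nontrivial W]
    (ρ : Representation ℂ (↥BorelSL2) W)
    (hrat : IsRationalRep borelEntries ρ)
    (hind : ∀ U₁ U₂ : Submodule ℂ W,
      (∀ g : ↥BorelSL2, ∀ v ∈ U₁, ρ g v ∈ U₁) →
      (∀ g : ↥BorelSL2, ∀ v ∈ U₂, ρ g v ∈ U₂) →
      IsCompl U₁ U₂ → U₁ = ⊥ ∨ U₂ = ⊥) :
    ∃ (W' : ModuleCat ℂ)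
      (σ : Representation ℂ (Matrix.SpecialLinearGroup (Fin 2) ℂ) W')
      (χ : ↥BorelSL2 →* ℂˣ) (e : W ≃ₗ[ℂ] W'),
      IsRationalRep sl2Entries σ ∧
      (∀ U : Submodule ℂ W',
        (∀ g : Matrix.SpecialLinearGroup (Fin 2) ℂ, ∀ v ∈ U, σ g v ∈ U) →
        U = ⊥ ∨ U = ⊤) ∧
      (∃ p : MvPolynomial (Fin 2 × Fin 2) ℂ, ∀ g : ↥BorelSL2,
        (χ g : ℂ) = MvPolynomial.eval (fun ij => borelEntries g ij.1 ij.2) p) ∧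
      (∀ (g : ↥BorelSL2) (v : W),
        e (ρ g v) = (χ g : ℂ) • σ (↑g : Matrix.SpecialLinearGroup (Fin 2) ℂ) (e v)) := by
  obtain ⟨n, E, hEn, hE⟩ := exists_unipotent_expansion hrat
  obtain ⟨l, w, r, s, hlw, hl, hw⟩ := exists_weight_pair hrat hEn
  have hzero : ∀ k < n, l (E k w) = 0 := fun k hk => weight_pair_coeff_eq_zero hE hlw hl hw hk
  have hker : LinearMap.ker (toBinaryForms n E l) = ⊥ := by
    refine (hind _ _ (fun g v hv => stringSpan_invariant hE hw g hv) (fun g v hv => ?_)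
      (isCompl_stringSpan_ker hE hlw hzero)).resolve_left fun h => ?_
    · rw [LinearMap.mem_ker] at hv ⊢
      rw [toBinaryForms_equivariant hE hl, hv, map_zero, smul_zero]
    · refine hlw ?_
      rw [(Submodule.eq_bot_iff _).1 h _ (coeff_mem_stringSpan E w n.lt_succ_self), map_zero]
  have hsurj : Function.Surjective (toBinaryForms n E l) := by
    rw [← LinearMap.range_eq_top, eq_top_iff, ← map_toBinaryForms_stringSpan hE hlw hzero]
    exact LinearMap.map_le_range
  exact ⟨ModuleCat.of ℂ (binaryForms n), binaryFormsRep n, borelCharacter ^ (r - n : ℤ),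
    LinearEquiv.ofBijective (toBinaryForms n E l) ⟨LinearMap.ker_eq_bot.1 hker, hsurj⟩,
    isRationalRep_binaryFormsRep n, binaryFormsRep_irreducible n,
    exists_polynomial_borelCharacter_zpow _, toBinaryForms_equivariant hE hl⟩
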